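/- Let G be a smooth generalized subbundle of the trivial bundle ℝⁿ × ℝᵐ, and let d ≥ 1 be an integer. Then there exist m smooth maps S_1, …, S_m : ℝⁿ → ℝᵐ with S_α(p) ∈ G(p) for all p ∈ ℝⁿ and all α, such that G(p) = span{S_1(p), …, S_m(p)} for every p with dim G(p) = d. -/

import Mathlib

open Set Filter Topology in
/-- A sequence of compactly supported smooth maps can be rescaled by positive constants so that
its sum converges to a smooth map. -/
theorem exists_pos_contDiff_tsum_smul {E F : Type*} [NormedAddCommGroup E] [NormedSpace ℝ E]
    [NormedAddCommGroup F] [NormedSpace ℝ F] [CompleteSpace F] {f : ℕ → E → F}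
    (hf : ∀ i, ContDiff ℝ (⊤ : ℕ∞) (f i)) (hc : ∀ i, HasCompactSupport (f i)) :
    ∃ c : ℕ → ℝ, (∀ i, 0 < c i) ∧ (∀ x, Summable fun i ↦ c i • f i x) ∧
      ContDiff ℝ (⊤ : ℕ∞) fun x ↦ ∑' i, c i • f i x := by
  have hbound : ∀ i k, ∃ R, ∀ x, ‖iteratedFDeriv ℝ k (f i) x‖ ≤ R := by
    intro i k
    obtain ⟨R, hR⟩ := ((hf i).continuous_iteratedFDeriv (m := k)
      (mod_cast le_top)).bounded_above_of_compact_support ((hc i).iteratedFDeriv k)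
    exact ⟨R, hR⟩
  choose R hR using hbound
  have hR0 : ∀ i k, 0 ≤ R i k := fun i k ↦ (norm_nonneg _).trans (hR i k 0)
  set M : ℕ → ℝ := fun i ↦ 1 + ∑ k ∈ Finset.range (i + 1), R i k
  have hM0 : ∀ i, 0 < M i := fun i ↦
    add_pos_of_pos_of_nonneg one_pos (Finset.sum_nonneg fun k _ ↦ hR0 i k)
  have hRM : ∀ i, ∀ k ≤ i, R i k ≤ M i := fun i k hk ↦
    (Finset.single_le_sum (f := R i) (fun k _ ↦ hR0 i k)
      (Finset.mem_range_succ_iff.2 hk)).trans (le_add_of_nonneg_left zero_le_one)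
  have hderiv : ∀ k i, k ≤ i → ∀ x,
      ‖iteratedFDeriv ℝ k (fun x ↦ ((1 / 2 : ℝ) ^ i / M i) • f i x) x‖ ≤ (1 / 2 : ℝ) ^ i := by
    intro k i hk x
    rw [iteratedFDeriv_const_smul_apply' ((hf i).of_le (mod_cast le_top)).contDiffAt, norm_smul,
      Real.norm_of_nonneg (div_pos (by positivity) (hM0 i)).le, div_mul_eq_mul_div,
      div_le_iff₀ (hM0 i)]
    gcongr
    exact (hR i k x).trans (hRM i k hk)
  refine ⟨fun i ↦ (1 / 2) ^ i / M i, fun i ↦ div_pos (by positivity) (hM0 i), fun x ↦ ?_, ?_⟩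
  · refine Summable.of_norm_bounded summable_geometric_two fun i ↦ ?_
    simpa using hderiv 0 i (Nat.zero_le i) x
  · refine contDiff_tsum_of_eventually (v := fun _ i ↦ (1 / 2 : ℝ) ^ i)
      (fun i ↦ contDiff_const.smul (hf i)) (fun _ _ ↦ summable_geometric_two) fun k _ ↦ ?_
    rw [Nat.cofinite_eq_atTop]
    filter_upwards [eventually_ge_atTop k] with i hi x using hderiv k i hi x

/-- A compactly supported smooth global section of the generalized subbundle `G`. -/
structure IsCompactSmoothSection {E F : Type*} [NormedAddCommGroup E] [NormedSpace ℝ E]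
    [NormedAddCommGroup F] [NormedSpace ℝ F] (G : E → Submodule ℝ F) (t : E → F) : Prop where
  contDiff : ContDiff ℝ (⊤ : ℕ∞) t
  hasCompactSupport : HasCompactSupport t
  mem : ∀ q, t q ∈ G q

open Set in
/-- Every local section agrees at a given point with a compactly supported global section. -/
theorem exists_isCompactSmoothSection_eq {E F : Type*} [NormedAddCommGroup E] [NormedSpace ℝ E]
    [FiniteDimensional ℝ E] [NormedAddCommGroup F] [NormedSpace ℝ F] {G : E → Submodule ℝ F}
    {U : Set E} {s : E → F} {p : E} (hU : IsOpen U) (hp : p ∈ U)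
    (hs : ContDiffOn ℝ (⊤ : ℕ∞) s U) (hsG : ∀ q ∈ U, s q ∈ G q) :
    ∃ t, IsCompactSmoothSection G t ∧ t p = s p := by
  obtain ⟨φ, hφU, hφc, hφ, -, hφp⟩ :=
    exists_contDiff_tsupport_subset (n := (⊤ : ℕ∞)) (hU.mem_nhds hp)
  refine ⟨fun q ↦ φ q • s q, ⟨?_, hφc.smul_right, fun q ↦ ?_⟩, by simp [hφp]⟩
  · rw [contDiff_iff_contDiffAt]
    intro q
    by_cases hq : q ∈ tsupport φ
    · exact hφ.contDiffAt.smul (hs.contDiffAt (hU.mem_nhds (hφU hq)))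
    · refine (contDiffAt_const (c := (0 : F))).congr_of_eventuallyEq ?_
      filter_upwards [(isClosed_tsupport φ).isOpen_compl.mem_nhds hq] with y hy
      simp [image_eq_zero_of_notMem_tsupport hy]
  · by_cases hq : q ∈ tsupport φ
    · exact (G q).smul_mem _ (hsG q (hφU hq))
    · simp [image_eq_zero_of_notMem_tsupport hq]

open Filter Topology in
/-- Near a point of the stratum `dim G = d`, finitely many global sections span `G` along that
stratum. -/
theorem exists_isCompactSmoothSection_eventually_span {E F : Type*} [NormedAddCommGroup E]
    [NormedSpace ℝ E] [NormedAddCommGroup F] [NormedSpace ℝ F] [FiniteDimensional ℝ F]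
    {G : E → Submodule ℝ F}
    (hG : ∀ p, ∀ v ∈ G p, ∃ t, IsCompactSmoothSection G t ∧ t p = v)
    {d : ℕ} {p : E} (hp : Module.finrank ℝ (G p) = d) :
    ∃ t : Fin d → E → F, (∀ k, IsCompactSmoothSection G (t k)) ∧
      ∀ᶠ q in 𝓝 p, Module.finrank ℝ (G q) = d →
        G q ≤ Submodule.span ℝ (Set.range fun k ↦ t k q) := by
  let b := Module.finBasisOfFinrankEq ℝ (G p) hp
  choose t ht htp using fun k ↦ hG p (b k) (b k).2
  have hind : LinearIndependent ℝ fun k ↦ t k p := by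
    simp_rw [htp]
    exact b.linearIndependent.map' (G p).subtype (Submodule.ker_subtype _)
  have hcont : Continuous fun q k ↦ t k q := continuous_pi fun k ↦ (ht k).contDiff.continuous
  refine ⟨t, ht, ?_⟩
  filter_upwards [hcont.continuousAt.eventually hind.eventually] with q hq hd
  refine (Submodule.eq_of_le_of_finrank_eq ?_ ?_).ge
  · exact Submodule.span_le.2 (Set.range_subset_iff.2 fun k ↦ (ht k).mem q)
  · rw [finrank_span_eq_card hq, hd, Fintype.card_fin]

open Set in
/-- Countably many global sections span `G` along the stratum `dim G = d`. -/
theorem exists_seq_isCompactSmoothSection_span {E F : Type*} [NormedAddCommGroup E]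
    [NormedSpace ℝ E] [SecondCountableTopology E] [NormedAddCommGroup F] [NormedSpace ℝ F]
    [FiniteDimensional ℝ F] {G : E → Submodule ℝ F}
    (hG : ∀ p, ∀ v ∈ G p, ∃ t, IsCompactSmoothSection G t ∧ t p = v) (d : ℕ) :
    ∃ t : ℕ → E → F, (∀ i, IsCompactSmoothSection G (t i)) ∧
      ∀ q, Module.finrank ℝ (G q) = d → G q ≤ Submodule.span ℝ (range fun i ↦ t i q) := by
  choose! t ht hspan using fun p (hp : Module.finrank ℝ (G p) = d) ↦
    exists_isCompactSmoothSection_eventually_span hG hp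
  obtain ⟨T, hTd, hT, hcover⟩ := TopologicalSpace.countable_cover_nhdsWithin
    fun p hp ↦ mem_nhdsWithin_of_mem_nhds (hspan p hp)
  have hcount : (insert 0 (⋃ p ∈ T, range (t p))).Countable :=
    (hT.biUnion fun p _ ↦ countable_range _).insert 0
  obtain ⟨u, hu⟩ := hcount.exists_eq_range (insert_nonempty _ _)
  refine ⟨u, fun i ↦ ?_, fun q hq ↦ ?_⟩
  · obtain h | h := hu.ge (mem_range_self i)
    · rw [h]
      exact ⟨contDiff_const, HasCompactSupport.zero, fun q ↦ (G q).zero_mem⟩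
    · obtain ⟨p, hp, k, hk⟩ := mem_iUnion₂.1 h
      exact hk ▸ ht p (hTd hp) k
  · obtain ⟨p, hp, hpq⟩ := mem_iUnion₂.1 (hcover hq)
    refine (hpq hq).trans (Submodule.span_mono (range_subset_iff.2 fun k ↦ ?_))
    obtain ⟨i, hi⟩ := hu.le (mem_insert_of_mem _ (mem_iUnion₂.2 ⟨p, hp, mem_range_self k⟩))
    exact ⟨i, congrFun hi q⟩

/-- A convergent sum of positive multiples of the rank-one operators `⟪t i, ·⟫ t i` has as range
the span of the vectors `t i`. -/
theorem range_eq_span_of_hasSum_smul_rankOne {F : Type*} [NormedAddCommGroup F]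
    [InnerProductSpace ℝ F] [FiniteDimensional ℝ F] {t : ℕ → F} {c : ℕ → ℝ} (hc : ∀ i, 0 < c i)
    {A : F →L[ℝ] F} (hA : HasSum (fun i ↦ c i • (innerSL ℝ (t i)).smulRight (t i)) A) :
    LinearMap.range (A : F →ₗ[ℝ] F) = Submodule.span ℝ (Set.range t) := by
  set W := Submodule.span ℝ (Set.range t)
  have ht : ∀ i, t i ∈ W := fun i ↦ Submodule.subset_span (Set.mem_range_self i)
  have hAx : ∀ x, HasSum (fun i ↦ c i • inner ℝ (t i) x • t i) (A x) := fun x ↦ by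
    simpa using hA.mapL (ContinuousLinearMap.apply ℝ F x)
  have hmem : ∀ x, A x ∈ W := fun x ↦ by
    refine W.closed_of_finiteDimensional.mem_of_tendsto (hAx x) (Filter.Eventually.of_forall ?_)
    exact fun s ↦ W.sum_mem fun i _ ↦ W.smul_mem _ (W.smul_mem _ (ht i))
  have hker : ∀ x ∈ W, A x = 0 → x = 0 := fun x hx h0 ↦ by
    have hsum : HasSum (fun i ↦ c i * inner ℝ (t i) x ^ 2) 0 := by
      simpa [h0, sq, real_inner_comm] using (hAx x).mapL (innerSL ℝ x)
    have hzero := (hasSum_zero_iff_of_nonneg fun i ↦ mul_nonneg (hc i).le (sq_nonneg _)).1 hsum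
    have horth : W ≤ LinearMap.ker (innerₛₗ ℝ x) := by
      refine Submodule.span_le.2 (Set.range_subset_iff.2 fun i ↦ ?_)
      have := congrFun hzero i
      simpa [(hc i).ne', real_inner_comm] using this
    exact inner_self_eq_zero.1 (horth hx)
  refine le_antisymm (LinearMap.range_le_iff_comap.2 (eq_top_iff.2 fun x _ ↦ hmem x)) ?_
  have hinj : Function.Injective ((A : F →ₗ[ℝ] F).restrict (p := W) (q := W) fun x _ ↦ hmem x) :=
    (injective_iff_map_eq_zero _).2 fun x hx ↦
      Subtype.ext (hker x x.2 (congrArg Subtype.val hx))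
  intro w hw
  obtain ⟨x, hx⟩ := LinearMap.injective_iff_surjective.1 hinj ⟨w, hw⟩
  exact ⟨x, congrArg Subtype.val hx⟩


/-- **`m` global sections spanning a smooth generalized subbundle of `ℝⁿ × ℝᵐ` on the set
where its dimension equals `d`.**  Let `G` be a smooth generalized subbundle of the trivial
bundle `ℝⁿ × ℝᵐ` and let `d ≥ 1`.  Then there are `m` smooth maps
`S 0, …, S (m-1) : ℝⁿ → ℝᵐ`, taking values in `G`, whose values span `G p` at every point
`p` with `dim (G p) = d`. -/
theorem smooth_subbundle_spanned_on_dimension_stratum {n m : ℕ}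
    (G : EuclideanSpace ℝ (Fin n) → Submodule ℝ (EuclideanSpace ℝ (Fin m)))
    (hG : ∀ p : EuclideanSpace ℝ (Fin n), ∀ v ∈ G p,
      ∃ (U : Set (EuclideanSpace ℝ (Fin n))) (s : EuclideanSpace ℝ (Fin n) → EuclideanSpace ℝ (Fin m)),
        IsOpen U ∧ p ∈ U ∧ ContDiffOn ℝ (⊤ : ℕ∞) s U ∧ (∀ q ∈ U, s q ∈ G q) ∧ s p = v)
    (d : ℕ) (hd : 1 ≤ d) :
    ∃ S : Fin m → EuclideanSpace ℝ (Fin n) → EuclideanSpace ℝ (Fin m),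
      (∀ α, ContDiff ℝ (⊤ : ℕ∞) (S α)) ∧
      (∀ α p, S α p ∈ G p) ∧
      (∀ p, Module.finrank ℝ (G p) = d →
        G p = Submodule.span ℝ (Set.range fun α ↦ S α p)) := by
  obtain ⟨t, ht, hspan⟩ := exists_seq_isCompactSmoothSection_span (G := G) (fun p v hv ↦ by
    obtain ⟨U, s, hU, hp, hs, hsG, rfl⟩ := hG p v hv
    exact exists_isCompactSmoothSection_eq hU hp hs hsG) d
  have hf : ∀ i, ContDiff ℝ (⊤ : ℕ∞) fun q ↦ (innerSL ℝ (t i q)).smulRight (t i q) := fun i ↦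
    ((innerSL ℝ).contDiff.comp (ht i).contDiff).smulRight (ht i).contDiff
  have hfc : ∀ i, HasCompactSupport fun q ↦ (innerSL ℝ (t i q)).smulRight (t i q) := fun i ↦
    (ht i).hasCompactSupport.comp_left (g := fun v ↦ (innerSL ℝ v).smulRight v) (by simp)
  obtain ⟨c, hc, hsum, hA⟩ := exists_pos_contDiff_tsum_smul hf hfc
  have hspan_t : ∀ q, Submodule.span ℝ (Set.range fun i ↦ t i q) ≤ G q := fun q ↦
    Submodule.span_le.2 (Set.range_subset_iff.2 fun i ↦ (ht i).mem q)
  let b := (EuclideanSpace.basisFun (Fin m) ℝ).toBasis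
  refine ⟨fun α q ↦ (∑' i, c i • (innerSL ℝ (t i q)).smulRight (t i q)) (b α),
    fun α ↦ hA.clm_apply contDiff_const, fun α q ↦ hspan_t q ?_, fun q hq ↦ ?_⟩
  · rw [← range_eq_span_of_hasSum_smul_rankOne hc (hsum q).hasSum]
    exact LinearMap.mem_range_self _ (b α)
  · rw [← (hspan_t q).antisymm (hspan q hq),
      ← range_eq_span_of_hasSum_smul_rankOne hc (hsum q).hasSum, LinearMap.range_eq_map,
      ← b.span_eq, Submodule.map_span, ← Set.range_comp]
    rfl
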